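/- Let n ≥ 1 and let X₁, …, Xₙ be measurable spaces. Let μ and ν be probability measures on X₁, and for each 1 ≤ i ≤ n−1 let κᵢ and λᵢ be Markov kernels from Xᵢ to X_{i+1}. Let P (respectively Q) be the joint law on X₁ × ⋯ × Xₙ of the Markov chain with initial distribution μ (respectively ν) and transition kernels κ₁, …, κ_{n−1} (respectively λ₁, …, λ_{n−1}), obtained by iterated composition-products in which the i-th transition depends only on the i-th coordinate. If ε₀ ≥ 0 satisfies TV(μ, ν) ≤ ε₀ and, for each 1 ≤ i ≤ n−1, εᵢ ≥ 0 satisfies TV(κᵢ(x), λᵢ(x)) ≤ εᵢ for all x ∈ Xᵢ, then TV(P, Q) ≤ ε₀ + ε₁ + ⋯ + ε_{n−1}. -/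

import Mathlib

open MeasureTheory ProbabilityTheory

universe u

/-- Total variation distance between two measures:
`TV(ρ, σ) = ⨆_{A measurable} |ρ(A) − σ(A)|`. -/
noncomputable def tvDist {Ω : Type*} [MeasurableSpace Ω] (ρ σ : Measure Ω) : ℝ :=
  ⨆ A : {A : Set Ω // MeasurableSet A}, |(ρ A.1).toReal - (σ A.1).toReal|

/-- The iterated product space `X 0 × X 1 × ⋯ × X n`, nested to the left. -/
def Hist (X : ℕ → Type u) : ℕ → Type u
  | 0 => X 0
  | n + 1 => Hist X n × X (n + 1)

instance Hist.instMeasurableSpace (X : ℕ → Type u) [∀ i, MeasurableSpace (X i)] :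
    ∀ n, MeasurableSpace (Hist X n)
  | 0 => inferInstanceAs (MeasurableSpace (X 0))
  | n + 1 => @Prod.instMeasurableSpace _ _ (Hist.instMeasurableSpace X n) inferInstance

/-- The last coordinate of a history in `X 0 × ⋯ × X n`. -/
def Hist.last (X : ℕ → Type u) : ∀ n, Hist X n → X n
  | 0, x => x
  | _ + 1, p => p.2

theorem Hist.measurable_last (X : ℕ → Type u) [∀ i, MeasurableSpace (X i)] :
    ∀ n, Measurable (Hist.last X n)
  | 0 => measurable_id
  | _ + 1 => measurable_snd

/-- The joint law on `X 0 × ⋯ × X n` of the Markov chain with initial distribution `μ` on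
`X 0` and transition kernels `κ i : Kernel (X i) (X (i+1))`, obtained by iterated
composition-products in which the `i`-th transition depends only on the `i`-th coordinate. -/
noncomputable def chainLaw (X : ℕ → Type u) [∀ i, MeasurableSpace (X i)]
    (μ : Measure (X 0)) (κ : ∀ i, Kernel (X i) (X (i + 1))) : ∀ n, Measure (Hist X n)
  | 0 => μ
  | n + 1 =>
    (chainLaw X μ κ n) ⊗ₘ ((κ n).comap (Hist.last X n) (Hist.measurable_last X n))

theorem tvDist_comm {Ω : Type*} [MeasurableSpace Ω] (ρ σ : Measure Ω) :
    tvDist ρ σ = tvDist σ ρ := by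
  simp only [tvDist, abs_sub_comm]

theorem tvDist_nonneg {Ω : Type*} [MeasurableSpace Ω] (ρ σ : Measure Ω) : 0 ≤ tvDist ρ σ :=
  Real.iSup_nonneg fun _ => abs_nonneg _

theorem measure_le_add_of_tvDist_le {Ω : Type*} [MeasurableSpace Ω] {ρ σ : Measure Ω}
    [IsFiniteMeasure ρ] [IsFiniteMeasure σ] {c : ℝ} (h : tvDist ρ σ ≤ c)
    {A : Set Ω} (hA : MeasurableSet A) : ρ A ≤ σ A + ENNReal.ofReal c := by
  have hbdd : BddAbove (Set.range fun B : {B : Set Ω // MeasurableSet B} =>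
      |(ρ B.1).toReal - (σ B.1).toReal|) := by
    refine ⟨ρ.real Set.univ + σ.real Set.univ, ?_⟩
    rintro _ ⟨B, rfl⟩
    refine (abs_sub _ _).trans ?_
    rw [abs_of_nonneg ENNReal.toReal_nonneg, abs_of_nonneg ENNReal.toReal_nonneg]
    exact add_le_add (measureReal_mono (Set.subset_univ _)) (measureReal_mono (Set.subset_univ _))
  have hA' := (le_abs_self _).trans ((le_ciSup hbdd ⟨A, hA⟩).trans h)
  have hc : 0 ≤ c := (tvDist_nonneg ρ σ).trans h
  rw [← ENNReal.ofReal_toReal (measure_ne_top ρ A), ← ENNReal.ofReal_toReal (measure_ne_top σ A),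
    ← ENNReal.ofReal_add ENNReal.toReal_nonneg hc]
  exact ENNReal.ofReal_le_ofReal (by linarith)

theorem tvDist_le_of_forall_measure_le_add {Ω : Type*} [MeasurableSpace Ω] {ρ σ : Measure Ω}
    [IsFiniteMeasure ρ] [IsFiniteMeasure σ] {c : ℝ} (hc : 0 ≤ c)
    (h₁ : ∀ A, MeasurableSet A → ρ A ≤ σ A + ENNReal.ofReal c)
    (h₂ : ∀ A, MeasurableSet A → σ A ≤ ρ A + ENNReal.ofReal c) : tvDist ρ σ ≤ c := by
  have key : ∀ {a b : ENNReal}, b ≠ ⊤ → a ≤ b + ENNReal.ofReal c → a.toReal ≤ b.toReal + c := by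
    intro a b hb hab
    have := ENNReal.toReal_mono (by finiteness) hab
    rwa [ENNReal.toReal_add hb ENNReal.ofReal_ne_top, ENNReal.toReal_ofReal hc] at this
  refine Real.iSup_le (fun A => abs_sub_le_iff.2 ⟨?_, ?_⟩) hc
  · linarith [key (measure_ne_top σ A) (h₁ A A.2)]
  · linarith [key (measure_ne_top ρ A) (h₂ A A.2)]

/-- A uniform setwise excess of `ρ` over `σ` also bounds the excess of the integral of any
function with values in `[0, 1]`. -/
theorem lintegral_le_lintegral_add_of_forall_measure_le_add {Ω : Type*} [MeasurableSpace Ω]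
    {ρ σ : Measure Ω} [IsFiniteMeasure ρ] [IsFiniteMeasure σ] {c : ENNReal}
    (h : ∀ A, MeasurableSet A → ρ A ≤ σ A + c) {f : Ω → ENNReal} (hf : ∀ x, f x ≤ 1) :
    ∫⁻ x, f x ∂ρ ≤ ∫⁻ x, f x ∂σ + c := by
  obtain ⟨s, hs⟩ := exists_isHahnDecomposition ρ σ
  have hsub : (ρ - σ) Set.univ ≤ c := by
    rw [← measure_add_measure_compl hs.measurableSet,
      Measure.sub_apply_eq_zero_of_isHahnDecomposition hs, zero_add, ← Measure.restrict_apply_self,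
      Measure.restrict_sub_eq_restrict_sub_restrict hs.measurableSet.compl,
      Measure.sub_apply hs.measurableSet.compl hs.ge_on_compl, Measure.restrict_apply_self,
      Measure.restrict_apply_self, tsub_le_iff_left]
    exact h _ hs.measurableSet.compl
  calc ∫⁻ x, f x ∂ρ ≤ ∫⁻ x, f x ∂(σ + (ρ - σ)) :=
        lintegral_mono' (add_comm σ (ρ - σ) ▸ Measure.sub_le_iff_le_add.1 le_rfl) le_rfl
    _ = ∫⁻ x, f x ∂σ + ∫⁻ x, f x ∂(ρ - σ) := lintegral_add_measure _ _ _
    _ ≤ ∫⁻ x, f x ∂σ + ∫⁻ _, 1 ∂(ρ - σ) := by gcongr; exact hf _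
    _ ≤ ∫⁻ x, f x ∂σ + c := by rw [lintegral_one]; gcongr

theorem compProd_apply_le_add_of_tvDist_le {α β : Type*} [MeasurableSpace α] [MeasurableSpace β]
    {μ ν : Measure α} [IsProbabilityMeasure μ] [IsFiniteMeasure ν]
    {κ η : Kernel α β} [IsMarkovKernel κ] [IsMarkovKernel η] {c e : ℝ} (he : 0 ≤ e)
    (hμν : tvDist μ ν ≤ c) (hκη : ∀ x, tvDist (κ x) (η x) ≤ e)
    {A : Set (α × β)} (hA : MeasurableSet A) :
    (μ ⊗ₘ κ) A ≤ (ν ⊗ₘ η) A + ENNReal.ofReal (c + e) := by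
  rw [Measure.compProd_apply hA, Measure.compProd_apply hA,
    ENNReal.ofReal_add ((tvDist_nonneg μ ν).trans hμν) he, ← add_assoc]
  calc ∫⁻ x, κ x (Prod.mk x ⁻¹' A) ∂μ
      ≤ ∫⁻ x, (η x (Prod.mk x ⁻¹' A) + ENNReal.ofReal e) ∂μ :=
        lintegral_mono fun x =>
          measure_le_add_of_tvDist_le (hκη x) (measurable_prodMk_left hA)
    _ = ∫⁻ x, η x (Prod.mk x ⁻¹' A) ∂μ + ENNReal.ofReal e := by
        rw [lintegral_add_right _ measurable_const, lintegral_const, measure_univ, mul_one]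
    _ ≤ _ := by
        gcongr
        exact lintegral_le_lintegral_add_of_forall_measure_le_add
          (fun _ => measure_le_add_of_tvDist_le hμν) fun _ => prob_le_one

theorem tvDist_compProd_le {α β : Type*} [MeasurableSpace α] [MeasurableSpace β]
    {μ ν : Measure α} [IsProbabilityMeasure μ] [IsProbabilityMeasure ν]
    {κ η : Kernel α β} [IsMarkovKernel κ] [IsMarkovKernel η] {c e : ℝ} (he : 0 ≤ e)
    (hμν : tvDist μ ν ≤ c) (hκη : ∀ x, tvDist (κ x) (η x) ≤ e) :
    tvDist (μ ⊗ₘ κ) (ν ⊗ₘ η) ≤ c + e :=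
  tvDist_le_of_forall_measure_le_add (add_nonneg ((tvDist_nonneg μ ν).trans hμν) he)
    (fun _ => compProd_apply_le_add_of_tvDist_le he hμν hκη)
    (fun _ => compProd_apply_le_add_of_tvDist_le he (by rwa [tvDist_comm])
      fun x => by rw [tvDist_comm]; exact hκη x)

theorem isProbabilityMeasure_chainLaw (X : ℕ → Type u) [∀ i, MeasurableSpace (X i)]
    (μ : Measure (X 0)) [hμ : IsProbabilityMeasure μ] (κ : ∀ i, Kernel (X i) (X (i + 1)))
    [∀ i, IsMarkovKernel (κ i)] : ∀ n, IsProbabilityMeasure (chainLaw X μ κ n)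
  | 0 => hμ
  | n + 1 => by
    have := isProbabilityMeasure_chainLaw X μ κ n
    exact inferInstanceAs (IsProbabilityMeasure
      ((chainLaw X μ κ n) ⊗ₘ ((κ n).comap (Hist.last X n) (Hist.measurable_last X n))))

/-- If `TV(μ, ν) ≤ ε 0` and for each transition `TV(κ i x, λ i x) ≤ ε (i+1)` uniformly in `x`,
then the joint laws of the two Markov chains on `X 0 × ⋯ × X (n-1)` (with `n` coordinates)
satisfy `TV(P, Q) ≤ ε 0 + ε 1 + ⋯ + ε (n-1)`. -/
theorem tvDist_chainLaw_le (n : ℕ) (hn : 1 ≤ n) (X : ℕ → Type u) [∀ i, MeasurableSpace (X i)]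
    (μ ν : Measure (X 0)) [IsProbabilityMeasure μ] [IsProbabilityMeasure ν]
    (κ lam : ∀ i, Kernel (X i) (X (i + 1)))
    [∀ i, IsMarkovKernel (κ i)] [∀ i, IsMarkovKernel (lam i)]
    (ε : ℕ → ℝ) (hε : ∀ i, 0 ≤ ε i)
    (hμν : tvDist μ ν ≤ ε 0)
    (hκ : ∀ i < n - 1, ∀ x : X i, tvDist (κ i x) (lam i x) ≤ ε (i + 1)) :
    tvDist (chainLaw X μ κ (n - 1)) (chainLaw X ν lam (n - 1)) ≤
      ∑ i ∈ Finset.range n, ε i := by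
  obtain ⟨m, rfl⟩ : ∃ m, n = m + 1 := ⟨n - 1, by omega⟩
  rw [Nat.add_sub_cancel] at hκ ⊢
  clear hn
  induction m with
  | zero =>
    rw [zero_add, Finset.sum_range_one]
    exact hμν
  | succ m ih =>
    have := isProbabilityMeasure_chainLaw X μ κ m
    have := isProbabilityMeasure_chainLaw X ν lam m
    rw [Finset.sum_range_succ]
    exact tvDist_compProd_le (hε _) (ih fun i hi => hκ i (by omega))
      fun x => hκ m (by omega) (Hist.last X m x)
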